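/- Let K be a commutative ring, R and S K-algebras, and M an (R,S)-bimodule with symmetric K-action. Let B be the triangular matrix K-algebra whose underlying K-module is R × M × S with multiplication (r, m, s)·(r', m', s') = (r·r', r·m' + m·s', s·s'), and let I = 0 × M × S, a two-sided ideal of B. Then the K-module Hom_{B^ev}(B, I) of B-bimodule homomorphisms B → I is isomorphic to Ann_S(M) ∩ Z(S), where Ann_S(M) = {s ∈ S : m·s = 0 for all m ∈ M} and Z(S) is the center of S; the isomorphism sends a bimodule homomorphism f to the S-component of f(1_B). -/

import Mathlib

open TensorProduct MulOpposite CategoryTheory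

noncomputable section TriLib

variable (R S M : Type) [Ring R] [Ring S]
  [AddCommGroup M] [Module R M] [Module Sᵐᵒᵖ M] [SMulCommClass R Sᵐᵒᵖ M]

/-- The triangular matrix ring `(R M; 0 S)`, with underlying additive group `R × M × S`. -/
def Tri : Type := R × M × S

instance : AddCommGroup (Tri R S M) := inferInstanceAs (AddCommGroup (R × M × S))

/-- The ring structure of the triangular matrix ring `(R M; 0 S)`. -/
instance : Ring (Tri R S M) :=
  { (inferInstance : AddCommGroup (Tri R S M)) with
    mul := fun x y => (x.1 * y.1, x.1 • y.2.1 + op y.2.2 • x.2.1, x.2.2 * y.2.2)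
    one := (1, 0, 1)
    mul_assoc := fun x y z => by
      refine Prod.ext (mul_assoc _ _ _) (Prod.ext ?_ (mul_assoc _ _ _))
      show (x.1 * y.1) • z.2.1 + op z.2.2 • (x.1 • y.2.1 + op y.2.2 • x.2.1)
          = x.1 • (y.1 • z.2.1 + op z.2.2 • y.2.1) + op (y.2.2 * z.2.2) • x.2.1
      rw [smul_add, smul_add, mul_smul, MulOpposite.op_mul, mul_smul,
        smul_comm x.1 (op z.2.2) y.2.1, add_assoc]
    one_mul := fun x => by
      refine Prod.ext (one_mul _) (Prod.ext ?_ (one_mul _))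
      show (1 : R) • x.2.1 + op x.2.2 • (0 : M) = x.2.1
      rw [one_smul, smul_zero, add_zero]
    mul_one := fun x => by
      refine Prod.ext (mul_one _) (Prod.ext ?_ (mul_one _))
      show x.1 • (0 : M) + op (1 : S) • x.2.1 = x.2.1
      rw [smul_zero, MulOpposite.op_one, one_smul, zero_add]
    left_distrib := fun x y z => by
      refine Prod.ext (mul_add _ _ _) (Prod.ext ?_ (mul_add _ _ _))
      show x.1 • (y.2.1 + z.2.1) + op (y.2.2 + z.2.2) • x.2.1
          = (x.1 • y.2.1 + op y.2.2 • x.2.1) + (x.1 • z.2.1 + op z.2.2 • x.2.1)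
      rw [smul_add, MulOpposite.op_add, add_smul]
      abel
    right_distrib := fun x y z => by
      refine Prod.ext (add_mul _ _ _) (Prod.ext ?_ (add_mul _ _ _))
      show (x.1 + y.1) • z.2.1 + op z.2.2 • (x.2.1 + y.2.1)
          = (x.1 • z.2.1 + op z.2.2 • x.2.1) + (y.1 • z.2.1 + op z.2.2 • y.2.1)
      rw [add_smul, smul_add]
      abel
    zero_mul := fun x => by
      refine Prod.ext (zero_mul _) (Prod.ext ?_ (zero_mul _))
      show (0 : R) • x.2.1 + op x.2.2 • (0 : M) = 0
      rw [zero_smul, smul_zero, add_zero]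
    mul_zero := fun x => by
      refine Prod.ext (mul_zero _) (Prod.ext ?_ (mul_zero _))
      show x.1 • (0 : M) + op (0 : S) • x.2.1 = 0
      rw [smul_zero, MulOpposite.op_zero, zero_smul, add_zero] }

@[simp] lemma tri_mul_def (x y : Tri R S M) :
    x * y = (x.1 * y.1, x.1 • y.2.1 + op y.2.2 • x.2.1, x.2.2 * y.2.2) := rfl
@[simp] lemma tri_one_def : (1 : Tri R S M) = ((1 : R), (0 : M), (1 : S)) := rfl

end TriLib


section Stmt15

variable (K R S M : Type) [CommRing K] [Ring R] [Ring S] [Algebra K R] [Algebra K S]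
  [AddCommGroup M] [Module R M] [Module Sᵐᵒᵖ M] [SMulCommClass R Sᵐᵒᵖ M]
  [Module K M] [IsScalarTower K R M] [IsScalarTower K Sᵐᵒᵖ M]

/-- The `K`-module structure on the triangular matrix algebra `B = (R M; 0 S)`. -/
instance : Module K (Tri R S M) := inferInstanceAs (Module K (R × M × S))

/-- The `K`-module of `B`-bimodule homomorphisms `B → I`, where `B = (R M; 0 S)` and
`I = (0 M; 0 S)`: additive maps `B → B` taking values in `I` which are both left and right
`B`-linear. -/
def TriBimodHom : Type :=
  {f : Tri R S M →+ Tri R S M //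
    (∀ x, (f x).1 = 0) ∧ (∀ b x, f (b * x) = b * f x) ∧ (∀ b x, f (x * b) = f x * b)}

/-- The map sending a bimodule homomorphism `f : B → I` to the `S`-component of `f(1)`. -/
def triPhi (f : TriBimodHom R S M) : S := (f.1 1).2.2

variable {R S M} in
lemma TriBimodHom.apply_eq_mul (f : TriBimodHom R S M) (x : Tri R S M) :
    f.1 x = x * f.1 1 := by
  rw [← f.2.2.1, mul_one]

variable {R S M} in
lemma TriBimodHom.commute_apply_one (f : TriBimodHom R S M) (x : Tri R S M) :
    x * f.1 1 = f.1 1 * x := by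
  rw [← f.2.2.1, ← f.2.2.2, mul_one, one_mul]

variable {R S M} in
lemma TriBimodHom.apply_one (f : TriBimodHom R S M) :
    f.1 1 = ((0 : R), (0 : M), triPhi R S M f) := by
  have h : (1 : R) • (f.1 1).2.1 + op (f.1 1).2.2 • (0 : M)
      = (f.1 1).1 • (0 : M) + op (0 : S) • (f.1 1).2.1 :=
    congrArg (fun y : R × M × S => y.2.1)
      (f.commute_apply_one ((1 : R), (0 : M), (0 : S)))
  refine Prod.ext (f.2.1 1) (Prod.ext ?_ rfl)
  simpa using h

variable {R S M} in
lemma TriBimodHom.op_triPhi_smul (f : TriBimodHom R S M) (m : M) :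
    op (triPhi R S M f) • m = 0 := by
  have h : (0 : R) • (f.1 1).2.1 + op (f.1 1).2.2 • m
      = (f.1 1).1 • m + op (0 : S) • (f.1 1).2.1 :=
    congrArg (fun y : R × M × S => y.2.1)
      (f.commute_apply_one ((0 : R), m, (0 : S)))
  rw [f.2.1 1] at h
  simpa [triPhi] using h

variable {R S M} in
lemma TriBimodHom.mul_triPhi_comm (f : TriBimodHom R S M) (t : S) :
    t * triPhi R S M f = triPhi R S M f * t :=
  congrArg (fun y : R × M × S => y.2.2)
    (f.commute_apply_one ((0 : R), (0 : M), t))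

lemma triPhi_injective : Function.Injective (triPhi R S M) := fun f g hfg => by
  refine Subtype.ext (AddMonoidHom.ext fun x => ?_)
  rw [f.apply_eq_mul, g.apply_eq_mul, f.apply_one, g.apply_one, hfg]

/-- The element `(0, 0, s)` of the triangular matrix ring. -/
def Tri.lowerRight (s : S) : Tri R S M := ((0 : R), (0 : M), s)

variable {R S M} in
lemma Tri.mul_lowerRight_comm {s : S} (hs : ∀ m : M, op s • m = 0)
    (hc : ∀ t : S, t * s = s * t) (b : Tri R S M) :
    b * Tri.lowerRight R S M s = Tri.lowerRight R S M s * b := by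
  refine Prod.ext ?_ (Prod.ext ?_ (hc b.2.2))
  · change b.1 * 0 = 0 * b.1
    simp
  · change b.1 • (0 : M) + op s • b.2.1 = (0 : R) • b.2.1 + op b.2.2 • (0 : M)
    simp [hs]

variable {R S M} in
/-- Right multiplication by `(0, 0, s)`, for a central element `s` of `S` annihilating `M`. -/
def TriBimodHom.ofCentral (s : S) (hs : ∀ m : M, op s • m = 0) (hc : ∀ t : S, t * s = s * t) :
    TriBimodHom R S M :=
  ⟨AddMonoidHom.mulRight (Tri.lowerRight R S M s),
    fun x => mul_zero x.1, fun b x => mul_assoc b x _, fun b x => by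
      rw [AddMonoidHom.mulRight_apply, AddMonoidHom.mulRight_apply, mul_assoc,
        Tri.mul_lowerRight_comm hs hc, mul_assoc]⟩

lemma range_triPhi :
    Set.range (triPhi R S M) = {s : S | (∀ m : M, op s • m = 0) ∧ s ∈ Set.center S} := by
  ext s
  simp only [Set.mem_range, Set.mem_ofPred_eq, Semigroup.mem_center_iff]
  constructor
  · rintro ⟨f, rfl⟩
    exact ⟨f.op_triPhi_smul, f.mul_triPhi_comm⟩
  · rintro ⟨hs, hc⟩
    exact ⟨TriBimodHom.ofCentral s hs hc, one_mul s⟩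

/-- STATEMENT 15: for the triangular matrix algebra `B = (R M; 0 S)` and the two-sided ideal
`I = (0 M; 0 S)`, the `K`-module `Hom_{B^ev}(B, I)` is isomorphic to `Ann_S(M) ∩ Z(S)` via
`f ↦ (f 1).S`; i.e. this map is injective, has range `Ann_S(M) ∩ Z(S)`, and is additive and
`K`-linear. -/
theorem stmt_15 :
    Function.Injective (triPhi R S M) ∧
    Set.range (triPhi R S M)
      = {s : S | (∀ m : M, op s • m = 0) ∧ s ∈ Set.center S} ∧
    (∀ f g h : TriBimodHom R S M,
      (∀ x, h.1 x = f.1 x + g.1 x) → triPhi R S M h = triPhi R S M f + triPhi R S M g) ∧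
    (∀ (k : K) (f h : TriBimodHom R S M),
      (∀ x, h.1 x = k • f.1 x) → triPhi R S M h = k • triPhi R S M f) := by
  exact ⟨triPhi_injective R S M, range_triPhi R S M,
    fun f g h hh => congrArg (fun y : R × M × S => y.2.2) (hh 1),
    fun k f h hh => congrArg (fun y : R × M × S => y.2.2) (hh 1)⟩

end Stmt15
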